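/- Let K be a field, let R = K[x, y, z] be the polynomial ring in three variables over K, and let I = (xy, xz). Then for every natural number i, the Ext group Ext^i_R(R/I, R) is nonzero if and only if i ∈ {1, 2}. Equivalently, the deficiency modules K^j(R/I), whose underlying modules are Ext^{3−j}_R(R/I, R), are nonzero exactly for j ∈ {1, 2}. -/

import Mathlib

open MvPolynomial CategoryTheory

open Limits ZeroObject

section LengthTwo

universe v u

variable {C : Type u} [Category.{v} C] [Abelian C] {P₂ P₁ P₀ Z : C}

/-- The chain complex `⋯ ⟶ 0 ⟶ P₂ ⟶ P₁ ⟶ P₀`. -/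
noncomputable def lengthTwoComplex (d₂ : P₂ ⟶ P₁) (d₁ : P₁ ⟶ P₀) (h : d₂ ≫ d₁ = 0) :
    ChainComplex C ℕ :=
  ChainComplex.mk P₀ P₁ P₂ d₁ d₂ h (fun _ => ⟨0, 0, zero_comp⟩)

lemma isZero_lengthTwoComplex_X (d₂ : P₂ ⟶ P₁) (d₁ : P₁ ⟶ P₀) (h : d₂ ≫ d₁ = 0) (n : ℕ) :
    IsZero ((lengthTwoComplex d₂ d₁ h).X (n + 3)) :=
  (isZero_zero C).of_iso (ChainComplex.mkXIso P₀ P₁ P₂ d₁ d₂ h (fun _ => ⟨0, 0, zero_comp⟩) n)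

@[simp]
lemma lengthTwoComplex_d_one_zero (d₂ : P₂ ⟶ P₁) (d₁ : P₁ ⟶ P₀) (h : d₂ ≫ d₁ = 0) :
    (lengthTwoComplex d₂ d₁ h).d 1 0 = d₁ :=
  ChainComplex.mk_d_1_0 ..

@[simp]
lemma lengthTwoComplex_d_two_one (d₂ : P₂ ⟶ P₁) (d₁ : P₁ ⟶ P₀) (h : d₂ ≫ d₁ = 0) :
    (lengthTwoComplex d₂ d₁ h).d 2 1 = d₂ :=
  ChainComplex.mk_d_2_1 ..

lemma lengthTwoComplex_exactAt_succ (d₂ : P₂ ⟶ P₁) (d₁ : P₁ ⟶ P₀) (h : d₂ ≫ d₁ = 0)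
    [Mono d₂] (h₁ : (ShortComplex.mk d₂ d₁ h).Exact) (n : ℕ) :
    (lengthTwoComplex d₂ d₁ h).ExactAt (n + 1) := by
  rw [HomologicalComplex.exactAt_iff' _ (n + 1 + 1) (n + 1) n (by simp) (by simp)]
  match n with
  | 0 =>
    refine (ShortComplex.exact_iff_of_iso ?_).2 h₁
    exact ShortComplex.isoMk (Iso.refl _) (Iso.refl _) (Iso.refl _)
      ((Category.id_comp _).trans
        ((lengthTwoComplex_d_two_one d₂ d₁ h).symm.trans (Category.comp_id _).symm))
      ((Category.id_comp _).trans
        ((lengthTwoComplex_d_one_zero d₂ d₁ h).symm.trans (Category.comp_id _).symm))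
  | 1 =>
    have : Mono ((lengthTwoComplex d₂ d₁ h).d 2 1) := by
      rw [lengthTwoComplex_d_two_one]; assumption
    exact (ShortComplex.exact_iff_mono ((lengthTwoComplex d₂ d₁ h).sc' 3 2 1)
      ((isZero_lengthTwoComplex_X d₂ d₁ h 0).eq_of_src _ _)).2 this
  | n + 2 => exact ShortComplex.exact_of_isZero_X₂ _ (isZero_lengthTwoComplex_X d₂ d₁ h n)

/-- The projective resolution attached to an exact sequence
`0 ⟶ P₂ ⟶ P₁ ⟶ P₀ ⟶ Z ⟶ 0` in which the `Pᵢ` are projective. -/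
noncomputable def lengthTwoResolution [Projective P₂] [Projective P₁] [Projective P₀]
    (d₂ : P₂ ⟶ P₁) (d₁ : P₁ ⟶ P₀) (ε : P₀ ⟶ Z) (h : d₂ ≫ d₁ = 0) (h' : d₁ ≫ ε = 0)
    [Mono d₂] [Epi ε] (h₁ : (ShortComplex.mk d₂ d₁ h).Exact)
    (h₀ : (ShortComplex.mk d₁ ε h').Exact) : ProjectiveResolution Z where
  complex := lengthTwoComplex d₂ d₁ h
  projective n := by
    match n with
    | 0 => assumption
    | 1 => assumption
    | 2 => assumption
    | n + 3 => exact (isZero_lengthTwoComplex_X d₂ d₁ h n).projective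
  π := (ChainComplex.toSingle₀Equiv _ _).symm
    ⟨ε, (congrArg (· ≫ ε) (lengthTwoComplex_d_one_zero d₂ d₁ h)).trans h'⟩
  quasiIso := ⟨fun n => by
    cases n
    · rw [ChainComplex.quasiIsoAt₀_iff, ShortComplex.quasiIso_iff_of_zeros']
      · refine (ShortComplex.exact_and_epi_g_iff_of_iso ?_).2 ⟨h₀, by assumption⟩
        exact ShortComplex.isoMk (Iso.refl _) (Iso.refl _) (Iso.refl _)
          ((Category.id_comp _).trans
            ((lengthTwoComplex_d_one_zero d₂ d₁ h).symm.trans (Category.comp_id _).symm))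
          ((Category.id_comp _).trans
            ((ChainComplex.toSingle₀Equiv_symm_apply_f_zero
              (C := lengthTwoComplex d₂ d₁ h) (X := Z) ε _).symm.trans
              (Category.comp_id _).symm))
      all_goals rfl
    · rw [quasiIsoAt_iff_exactAt']
      · exact lengthTwoComplex_exactAt_succ d₂ d₁ h h₁ _
      · apply ChainComplex.exactAt_succ_single_obj⟩

end LengthTwo

section ExtCriterion

universe v u

variable {C : Type u} [Category.{v} C] [Abelian C] {R : Type*} [Ring R] [Linear R C]
  [EnoughProjectives C] {X : C}

lemma nontrivial_ext_iff_not_exactAt (P : ProjectiveResolution X) (Y : C) (n : ℕ) :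
    Nontrivial (((Ext R C n).obj (Opposite.op X)).obj Y) ↔
      ¬ (P.complex.linearYonedaObj R Y).ExactAt n := by
  rw [HomologicalComplex.exactAt_iff_isZero_homology, ← (P.isoExt n Y).isZero_iff,
    ModuleCat.isZero_iff_subsingleton, not_subsingleton_iff_nontrivial]

lemma nontrivial_ext_zero_iff (P : ProjectiveResolution X) (Y : C) :
    Nontrivial (((Ext R C 0).obj (Opposite.op X)).obj Y) ↔
      ∃ f : P.complex.X 0 ⟶ Y, P.complex.d 1 0 ≫ f = 0 ∧ f ≠ 0 := by
  rw [nontrivial_ext_iff_not_exactAt P,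
    HomologicalComplex.exactAt_iff' _ 0 0 1 (by simp) (by simp),
    ShortComplex.moduleCat_exact_iff]
  push Not
  refine exists_congr fun f => and_congr Iff.rfl ?_
  have h0 : (P.complex.linearYonedaObj R Y).d 0 0 = 0 :=
    HomologicalComplex.shape _ _ _ (by simp)
  constructor
  · rintro h rfl
    exact h 0 (map_zero _)
  · intro h g hg
    refine h (hg.symm.trans ?_)
    change (P.complex.linearYonedaObj R Y).d 0 0 g = 0
    rw [h0]; rfl

lemma nontrivial_ext_succ_iff (P : ProjectiveResolution X) (Y : C) (n : ℕ) :
    Nontrivial (((Ext R C (n + 1)).obj (Opposite.op X)).obj Y) ↔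
      ∃ f : P.complex.X (n + 1) ⟶ Y, P.complex.d (n + 2) (n + 1) ≫ f = 0 ∧
        ∀ g : P.complex.X n ⟶ Y, P.complex.d (n + 1) n ≫ g ≠ f := by
  rw [nontrivial_ext_iff_not_exactAt P,
    HomologicalComplex.exactAt_iff' _ n (n + 1) (n + 2) (by simp) (by simp),
    ShortComplex.moduleCat_exact_iff]
  push Not
  rfl

end ExtCriterion

section QuotientResolution

universe u

variable {R : Type u} [CommRing R] (x y z : R)

/-- The map `R → R²` sending `1` to the syzygy `(z, -y)` of `(xy, xz)`. -/
def syzygyMap : R →ₗ[R] R × R :=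
  (LinearMap.mulLeft R z).prod (-LinearMap.mulLeft R y)

/-- The map `R² → R` with image `(xy, xz)`. -/
def generatorMap : R × R →ₗ[R] R :=
  (LinearMap.mulLeft R (x * y)).coprod (LinearMap.mulLeft R (x * z))

@[simp] lemma syzygyMap_apply (c : R) : syzygyMap y z c = (z * c, -(y * c)) := rfl

@[simp] lemma generatorMap_apply (a : R × R) :
    generatorMap x y z a = x * y * a.1 + x * z * a.2 := rfl

variable [IsDomain R] {x y z}

/-- The free resolution `0 → R → R² → R → R/(xy, xz) → 0`. -/
noncomputable def quotientResolution (hx : x ≠ 0) (hz : z ≠ 0)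
    (hyz : ∀ a, z ∣ y * a → z ∣ a) :
    ProjectiveResolution (ModuleCat.of R (R ⧸ Ideal.span {x * y, x * z})) :=
  haveI : Mono (ModuleCat.ofHom (syzygyMap y z)) := by
    rw [ModuleCat.mono_iff_injective]
    intro a b hab
    exact mul_left_cancel₀ hz (congrArg Prod.fst hab)
  haveI : Epi (ModuleCat.ofHom (Ideal.span {x * y, x * z}).mkQ) := by
    rw [ModuleCat.epi_iff_surjective]
    exact Submodule.mkQ_surjective _
  haveI : Projective (ModuleCat.of R R) :=
    ModuleCat.projective_of_free (Module.Free.chooseBasis R R)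
  haveI : Projective (ModuleCat.of R (R × R)) :=
    ModuleCat.projective_of_free (Module.Free.chooseBasis R (R × R))
  lengthTwoResolution (ModuleCat.ofHom (syzygyMap y z)) (ModuleCat.ofHom (generatorMap x y z))
    (ModuleCat.ofHom (Ideal.span {x * y, x * z}).mkQ)
    (by
      ext
      simp
      ring)
    (by
      ext
      · refine (Submodule.Quotient.mk_eq_zero _).2 (Ideal.mem_span_pair.2 ⟨1, 0, ?_⟩)
        change 1 * (x * y) + 0 * (x * z) = x * y * 1 + x * z * 0
        ring
      · refine (Submodule.Quotient.mk_eq_zero _).2 (Ideal.mem_span_pair.2 ⟨0, 1, ?_⟩)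
        change 0 * (x * y) + 1 * (x * z) = x * y * 0 + x * z * 1
        ring)
    (by
      rw [ShortComplex.moduleCat_exact_iff]
      rintro ⟨a, b⟩ (hab : x * y * a + x * z * b = 0)
      have h : y * a + z * b = 0 := by
        refine (mul_eq_zero.1 (?_ : x * (y * a + z * b) = 0)).resolve_left hx
        linear_combination hab
      obtain ⟨c, rfl⟩ := hyz a ⟨-b, by linear_combination h⟩
      refine ⟨c, Prod.ext rfl ?_⟩
      refine mul_left_cancel₀ hz ?_
      change z * (-(y * c)) = z * b
      linear_combination -h)
    (by
      rw [ShortComplex.moduleCat_exact_iff]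
      intro r hr
      obtain ⟨a, b, h⟩ := Ideal.mem_span_pair.1 ((Submodule.Quotient.mk_eq_zero _).1 hr)
      refine ⟨(a, b), ?_⟩
      change x * y * a + x * z * b = r
      linear_combination h)

/-- If `x` is a nonzero nonunit of a domain `R` and `z, y` is a regular sequence generating a
proper ideal, then `Ext^i(R/(xy, xz), R)` is nonzero exactly for `i = 1, 2`. -/
theorem nontrivial_ext_quotient_iff (hx : x ≠ 0) (hx' : ¬ IsUnit x) (hz : z ≠ 0)
    (hyz : ∀ a, z ∣ y * a → z ∣ a) (hyz' : Ideal.span {y, z} ≠ ⊤) (i : ℕ) :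
    Nontrivial (((Ext R (ModuleCat.{u} R) i).obj
      (Opposite.op (ModuleCat.of R (R ⧸ Ideal.span {x * y, x * z})))).obj (ModuleCat.of R R)) ↔
      i = 1 ∨ i = 2 := by
  let P := quotientResolution hx hz hyz
  have d₁ : P.complex.d 1 0 = ModuleCat.ofHom (generatorMap x y z) :=
    lengthTwoComplex_d_one_zero ..
  have d₂ : P.complex.d 2 1 = ModuleCat.ofHom (syzygyMap y z) :=
    lengthTwoComplex_d_two_one ..
  match i with
  | 0 =>
    rw [nontrivial_ext_zero_iff P, d₁]
    simp only [zero_ne_one, OfNat.zero_ne_ofNat, or_self, iff_false, not_exists, not_and, not_not]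
    intro (f : ModuleCat.of R R ⟶ ModuleCat.of R R) hf
    have h : f.hom (x * y * 0 + x * z * 1) = 0 := congrArg (fun g => g.hom ((0, 1) : R × R)) hf
    refine ModuleCat.hom_ext (LinearMap.ext_ring ?_)
    have h' : (x * z) * f.hom (1 : R) = 0 := by
      rw [← smul_eq_mul, ← map_smul, smul_eq_mul, ← h]; congr 1; ring
    exact (mul_eq_zero.1 h').resolve_left (mul_ne_zero hx hz)
  | 1 =>
    rw [nontrivial_ext_succ_iff P, d₁, d₂]
    simp only [true_or, iff_true]
    refine ⟨ModuleCat.ofHom ((LinearMap.mulLeft R y).coprod (LinearMap.mulLeft R z)), ?_, ?_⟩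
    · refine ModuleCat.hom_ext (LinearMap.ext_ring ?_)
      change y * (z * 1) + z * (-(y * 1)) = 0
      ring
    · intro (g : ModuleCat.of R R ⟶ ModuleCat.of R R) hg
      have h : g.hom (x * y * 0 + x * z * 1) = y * 0 + z * 1 :=
        congrArg (fun g => g.hom ((0, 1) : R × R)) hg
      have h' : (x * z) * g.hom (1 : R) = z := by
        rw [← smul_eq_mul, ← map_smul, smul_eq_mul]
        refine Eq.trans ?_ (h.trans (by ring))
        congr 1; ring
      refine hx' (IsUnit.of_mul_eq_one (g.hom (1 : R)) (mul_left_cancel₀ hz ?_))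
      linear_combination h'
  | 2 =>
    rw [nontrivial_ext_succ_iff P, d₂]
    simp only [or_true, iff_true]
    refine ⟨𝟙 (ModuleCat.of R R),
      (isZero_lengthTwoComplex_X _ _ _ 0).eq_of_src _ _, ?_⟩
    intro (g : ModuleCat.of R (R × R) ⟶ ModuleCat.of R R) hg
    have h : g.hom ((z * 1, -(y * 1)) : R × R) = 1 := congrArg (fun g => g.hom (1 : R)) hg
    have hsplit : ((z * 1, -(y * 1)) : R × R) = z • ((1, 0) : R × R) + (-y) • ((0, 1) : R × R) := by
      simp
    rw [hsplit, map_add, map_smul, map_smul, smul_eq_mul, smul_eq_mul] at h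
    refine hyz' ((Ideal.eq_top_iff_one _).2 (Ideal.mem_span_pair.2
      ⟨-g.hom ((0, 1) : R × R), g.hom ((1, 0) : R × R), ?_⟩))
    linear_combination h
  | n + 3 =>
    rw [nontrivial_ext_succ_iff P]
    refine iff_of_false ?_ (by omega)
    rintro ⟨f, -, hf⟩
    exact hf 0 ((isZero_lengthTwoComplex_X _ _ _ n).eq_of_src _ _)

end QuotientResolution

/-- Let `R = K[x, y, z]` (with `x = X 0`, `y = X 1`, `z = X 2`) and `I = (xy, xz)`.
Then `Ext^i_R(R/I, R) ≠ 0` if and only if `i ∈ {1, 2}`; equivalently, the deficiency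
modules `K^j(R/I) = Ext^{3-j}_R(R/I, R(-3))` are nonzero exactly for `j ∈ {1, 2}`. -/
theorem ext_nonzero_iff_nonpure_monomial_example {K : Type*} [Field K] (i : ℕ) :
    Nontrivial
      (((Ext (MvPolynomial (Fin 3) K) (ModuleCat (MvPolynomial (Fin 3) K)) i).obj
          (Opposite.op (ModuleCat.of (MvPolynomial (Fin 3) K)
            (MvPolynomial (Fin 3) K ⧸ Ideal.span
              {(X 0 * X 1 : MvPolynomial (Fin 3) K), X 0 * X 2})))).obj
        (ModuleCat.of (MvPolynomial (Fin 3) K) (MvPolynomial (Fin 3) K))) ↔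
      i = 1 ∨ i = 2 := by
  refine nontrivial_ext_quotient_iff (X_ne_zero 0) (X_prime (i := 0)).not_isUnit (X_ne_zero 2) ?_ ?_ i
  · intro a h
    refine ((X_prime (i := 2)).dvd_or_dvd h).resolve_left fun h' => ?_
    simp at h'
  · intro h
    obtain ⟨a, b, hab⟩ := Ideal.mem_span_pair.1 ((Ideal.eq_top_iff_one _).1 h)
    simpa using congrArg constantCoeff hab
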